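/- Let k_1, k_2 ≥ 0 and d, s be integers with d > k_1 + k_2 + 1 and 0 ≤ s ≤ d. Then there exist complex numbers c_0, c_1, …, c_s with c_0 ≠ 0 such that c_j = 0 for every j with d - k_1 ≤ j ≤ s, and Σ_{k=0}^{j} binom(j, j-k)·c_k = 0 for every j with d - k_2 ≤ j ≤ s. -/

import Mathlib

noncomputable section

/-- Let `k₁, k₂ ≥ 0`, `d > k₁ + k₂ + 1` and `0 ≤ s ≤ d`. Then there exist
complex numbers `c_0, …, c_s` with `c_0 ≠ 0` such that `c_j = 0` for every `j` with
`d - k₁ ≤ j ≤ s`, and `Σ_{k=0}^{j} binom(j, j-k)·c_k = 0` for every `j` with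
`d - k₂ ≤ j ≤ s`. -/
theorem osculating_linear_system_solvable (k₁ k₂ d s : ℕ)
    (hd : k₁ + k₂ + 1 < d) (hs : s ≤ d) :
    ∃ c : ℕ → ℂ, c 0 ≠ 0 ∧
      (∀ j : ℕ, d - k₁ ≤ j → j ≤ s → c j = 0) ∧
      (∀ j : ℕ, d - k₂ ≤ j → j ≤ s →
        ∑ k ∈ Finset.range (j + 1), (j.choose (j - k) : ℂ) * c k = 0) := by
  let P : Polynomial ℂ := ∏ i ∈ Finset.Icc (d - k₂) d, (Polynomial.X - Polynomial.C (i : ℂ))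
  have hdeg : P.natDegree = d + 1 - (d - k₂) := by
    simp only [P]
    rw [Polynomial.natDegree_prod_of_monic _ _ (fun i _ => Polynomial.monic_X_sub_C _)]
    simp only [Polynomial.natDegree_X_sub_C, Finset.sum_const, Nat.card_Icc, smul_eq_mul, mul_one]
  refine ⟨fun k => (fwdDiff (1 : ℂ))^[k] P.eval 0, ?_, ?_, ?_⟩
  · simp only [Function.iterate_zero, id, P, Polynomial.eval_prod]
    rw [Finset.prod_ne_zero_iff]
    intro i hi
    rw [Finset.mem_Icc] at hi
    have : i ≠ 0 := by omega
    simpa using this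
  · intro j hj _
    have h := Polynomial.fwdDiff_iter_eq_zero_of_degree_lt (P := P) (n := j) (by omega)
    exact congrFun h 0
  · intro j hj hjs
    have h := shift_eq_sum_fwdDiff_iter (1 : ℂ) P.eval j 0
    have h0 : P.eval ((0 : ℂ) + j • (1 : ℂ)) = 0 := by
      simp only [P, Polynomial.eval_prod]
      apply Finset.prod_eq_zero (i := j)
      · rw [Finset.mem_Icc]; omega
      · simp
    rw [h0] at h
    refine Eq.trans ?_ h.symm
    apply Finset.sum_congr rfl
    intro k hk
    rw [Finset.mem_range] at hk
    rw [Nat.choose_symm (by omega), nsmul_eq_mul]
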